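/- Fix K < ∞ and let {(ψⁿ, Pⁿ)}_{n≥1} be a sequence such that each (ψⁿ, Pⁿ) is a viable pair (for Regime 2 with initial point x₀), ∫ ‖z‖² Pⁿ(dz dy dt) < K for every n, ψⁿ → ψ uniformly on [0,1], and Pⁿ → P weakly. Then (ψ, P) is a viable pair (for Regime 2 with initial point x₀). -/

import Mathlib

open MeasureTheory Matrix Filter

noncomputable section

/-- The control space `Z = ℝ^d`. -/
abbrev Ctrl (d : ℕ) := Fin d → ℝ

/-- The `d`-dimensional torus `𝕋^d = ℝ^d/ℤ^d`. -/
abbrev Torus (d : ℕ) := Fin d → AddCircle (1 : ℝ)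

/-- The time interval `[0,1]`. -/
abbrev I01 := Set.Icc (0 : ℝ) 1

/-- The space `ℝ^d × 𝕋^d × [0,1]` on which occupation measures live. -/
abbrev Spc (d : ℕ) := Ctrl d × Torus d × I01

/-- The canonical projection `ℝ^d → 𝕋^d`. -/
def torusProj (d : ℕ) (w : Fin d → ℝ) : Torus d := fun i => (w i : AddCircle (1 : ℝ))

/-- `λ₂(x,y,z) = γ b(x,y) + c(x,y) + σ(x,y) z`. -/
def lam2 {d : ℕ} (γ : ℝ) (b c : (Fin d → ℝ) → Torus d → Fin d → ℝ)
    (σ : (Fin d → ℝ) → Torus d → Matrix (Fin d) (Fin d) ℝ)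
    (x : Fin d → ℝ) (y : Torus d) (z : Ctrl d) : Fin d → ℝ :=
  fun i => γ * b x y i + c x y i + (σ x y).mulVec z i

/-- A function `F : ℝ^d → ℝ` is a `C²` representative of a test function on the torus
if it is twice continuously differentiable and `ℤ^d`-periodic. -/
def IsC2Periodic {d : ℕ} (F : (Fin d → ℝ) → ℝ) : Prop :=
  ContDiff ℝ 2 F ∧ ∀ (w : Fin d → ℝ) (m : Fin d → ℤ), F (w + fun i => (m i : ℝ)) = F w

/-- The generator `ℒ²_{z,x} f(y)`, expressed through a periodic representative
`F = f ∘ π` on `ℝ^d`: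
`ℒ²_{z,x}F(w) = λ₂(x, π w, z)·∇F(w) + (γ/2) Σ_{ij} (σσᵀ)_{ij}(x, π w) ∂²F(w)/∂w_i∂w_j`. -/
def gen2 {d : ℕ} (γ : ℝ) (b c : (Fin d → ℝ) → Torus d → Fin d → ℝ)
    (σ : (Fin d → ℝ) → Torus d → Matrix (Fin d) (Fin d) ℝ)
    (x : Fin d → ℝ) (z : Ctrl d) (F : (Fin d → ℝ) → ℝ) (w : Fin d → ℝ) : ℝ :=
  (∑ i, lam2 γ b c σ x (torusProj d w) z i * fderiv ℝ F w (Pi.single i 1)) +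
    (γ / 2) * ∑ i, ∑ j, (σ x (torusProj d w) * (σ x (torusProj d w))ᵀ) i j *
      fderiv ℝ (fun v => fderiv ℝ F v (Pi.single j 1)) w (Pi.single i 1)

/-- A pair `(ψ, P)`, with `ψ ∈ C([0,1]; ℝ^d)` and `P` a Borel probability measure on
`ℝ^d × 𝕋^d × [0,1]`, is *viable* (for Regime 2 with initial point `x₀`) if
`P` has finite second moment in `z`, `ψ_t = x₀ + ∫_{ℝ^d×𝕋^d×[0,t]} λ₂(ψ_s,y,z) dP`,
`∫_{ℝ^d×𝕋^d×[0,t]} ℒ²_{z,ψ_s} f(y) dP = 0` for every `f ∈ C²(𝕋^d)` and `t ∈ [0,1]`,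
and the last marginal of `P` is Lebesgue measure. -/
def IsViablePair {d : ℕ} (γ : ℝ) (x₀ : Fin d → ℝ)
    (b c : (Fin d → ℝ) → Torus d → Fin d → ℝ)
    (σ : (Fin d → ℝ) → Torus d → Matrix (Fin d) (Fin d) ℝ)
    (ψ : C(I01, Fin d → ℝ)) (P : Measure (Spc d)) : Prop :=
  IsProbabilityMeasure P ∧
  Integrable (fun p : Spc d => ∑ i, (p.1 i) ^ 2) P ∧
  (∀ t : I01, ψ t = fun i => x₀ i +
      ∫ p in {p : Spc d | (p.2.2 : ℝ) ≤ (t : ℝ)}, lam2 γ b c σ (ψ p.2.2) p.2.1 p.1 i ∂P) ∧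
  (∀ F : (Fin d → ℝ) → ℝ, IsC2Periodic F →
    ∀ g : Spc d → ℝ,
      (∀ (z : Ctrl d) (w : Fin d → ℝ) (s : I01), g (z, torusProj d w, s) = gen2 γ b c σ (ψ s) z F w) →
      ∀ t : I01, ∫ p in {p : Spc d | (p.2.2 : ℝ) ≤ (t : ℝ)}, g p ∂P = 0) ∧
  (∀ t : I01, P {p : Spc d | (p.2.2 : ℝ) ≤ (t : ℝ)} = ENNReal.ofReal t)

end

section WeakLimits

variable {X : Type*} [TopologicalSpace X]

/-- Weak limits preserve upper bounds on integrals of nonnegative continuous functions. -/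
theorem integrable_and_integral_le_of_weakLimit
    [MeasurableSpace X] [BorelSpace X] {Q : ℕ → Measure X} {P : Measure X}
    [IsFiniteMeasure P] [∀ n, IsFiniteMeasure (Q n)]
    (hP : ∀ g : BoundedContinuousFunction X ℝ,
      Tendsto (fun n => ∫ p, g p ∂(Q n)) atTop (nhds (∫ p, g p ∂P)))
    {N : X → ℝ} (hN : Continuous N) (hN0 : ∀ p, 0 ≤ N p) {K : ℝ}
    (hint : ∀ n, Integrable N (Q n)) (hK : ∀ n, ∫ p, N p ∂(Q n) ≤ K) :
    Integrable N P ∧ ∫ p, N p ∂P ≤ K := by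
  have hK0 : 0 ≤ K := (integral_nonneg hN0).trans (hK 0)
  have hnn : ∀ (m : ℕ) p, 0 ≤ min (N p) m := fun m p => le_min (hN0 p) m.cast_nonneg
  have htrunc : ∀ m : ℕ, ∫ p, min (N p) m ∂P ≤ K := by
    intro m
    have hb : ∀ p, ‖min (N p) (m : ℝ)‖ ≤ m := fun p => by
      rw [Real.norm_of_nonneg (hnn m p)]; exact min_le_right _ _
    refine le_of_tendsto (hP (BoundedContinuousFunction.ofNormedAddCommGroup
      (fun p => min (N p) (m : ℝ)) (by fun_prop) m hb)) (Eventually.of_forall fun n => ?_)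
    exact (integral_mono_of_nonneg (Eventually.of_forall (hnn m)) (hint n)
      (Eventually.of_forall fun p => min_le_left _ _)).trans (hK n)
  have hlin : ∫⁻ p, ENNReal.ofReal (N p) ∂P ≤ ENNReal.ofReal K := by
    have hsup : ∀ p, ENNReal.ofReal (N p) = ⨆ m : ℕ, ENNReal.ofReal (min (N p) m) := by
      intro p
      refine le_antisymm ?_ (iSup_le fun m => ENNReal.ofReal_le_ofReal (min_le_left _ _))
      refine le_iSup_of_le ⌈N p⌉₊ (ENNReal.ofReal_le_ofReal ?_)
      exact le_min le_rfl (Nat.le_ceil _)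
    simp_rw [hsup]
    rw [lintegral_iSup (f := fun (m : ℕ) p => ENNReal.ofReal (min (N p) m))
      (fun m => (hN.min continuous_const).measurable.ennreal_ofReal)
      (fun m m' h p => ENNReal.ofReal_le_ofReal (min_le_min_left _ (Nat.cast_le.2 h)))]
    refine iSup_le fun m => ?_
    rw [← ofReal_integral_eq_lintegral_ofReal _ (Eventually.of_forall (hnn m))]
    · exact ENNReal.ofReal_le_ofReal (htrunc m)
    · refine Integrable.of_bound (by fun_prop) (m : ℝ) (Eventually.of_forall fun p => ?_)
      rw [Real.norm_of_nonneg (hnn m p)]; exact min_le_right _ _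
  have hI : Integrable N P :=
    ⟨hN.aestronglyMeasurable, (hasFiniteIntegral_iff_ofReal (Eventually.of_forall hN0)).2
      (hlin.trans_lt ENNReal.ofReal_lt_top)⟩
  refine ⟨hI, ?_⟩
  rw [← ofReal_integral_eq_lintegral_ofReal hI (Eventually.of_forall hN0)] at hlin
  exact (ENNReal.ofReal_le_ofReal_iff hK0).1 hlin

/-- Quantitative replacement of an integrand of controlled growth on `τ ⁻¹' B` by a bounded one
multiplied by an approximate indicator. -/
theorem abs_setIntegral_sub_integral_le
    [MeasurableSpace X] [BorelSpace X]
    {S : Type*} [TopologicalSpace S] [MeasurableSpace S] [BorelSpace S]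
    {Q : Measure X} [IsProbabilityMeasure Q] {τ : X → S}
    (hτ : Continuous τ) {B : Set S} (hB : MeasurableSet B)
    {N : X → ℝ} (hint : Integrable N Q) {K : ℝ} (hK : ∫ p, N p ∂Q ≤ K)
    {k : X → ℝ} (hk : Continuous k) (g : BoundedContinuousFunction X ℝ) {a : ℝ} (ha : 0 ≤ a)
    (hkg : ∀ p, |k p - g p| ≤ a * (1 + N p)) {M : ℝ} (hgM : ∀ p, |g p| ≤ M)
    (φ : BoundedContinuousFunction S ℝ) :
    |∫ p in τ ⁻¹' B, k p ∂Q - ∫ p, φ (τ p) * g p ∂Q| ≤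
      a * (1 + K) + M * ∫ s, ‖B.indicator (fun _ => (1 : ℝ)) s - φ s‖ ∂(Q.map τ) := by
  have hτm : Measurable τ := hτ.measurable
  have hA : MeasurableSet (τ ⁻¹' B) := hτm hB
  have hgi : Integrable g Q := g.integrable Q
  have hdom : Integrable (fun p => a * (1 + N p)) Q := ((integrable_const 1).add hint).const_mul a
  have hki : Integrable k Q := by
    have : Integrable (fun p => k p - g p) Q :=
      hdom.mono' (hk.sub g.continuous).aestronglyMeasurable (Eventually.of_forall hkg)
    exact (this.add hgi).congr (Eventually.of_forall fun p => by simp)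
  have hφgi : Integrable (fun p => φ (τ p) * g p) Q :=
    hgi.bdd_mul (φ.continuous.comp hτ).aestronglyMeasurable
      (Eventually.of_forall fun p => φ.norm_coe_le_norm (τ p))
  have hfin : IsFiniteMeasure (Q.map τ) := inferInstance
  have hind : Integrable (fun s => ‖B.indicator (fun _ => (1 : ℝ)) s - φ s‖) (Q.map τ) :=
    (((integrable_const 1).indicator hB).sub (φ.integrable _)).norm
  have hindτ : Integrable (fun p => ‖B.indicator (fun _ => (1 : ℝ)) (τ p) - φ (τ p)‖) Q :=
    hind.comp_measurable hτm
  rw [← integral_indicator hA, ← integral_sub (hki.indicator hA) hφgi,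
    integral_map hτm.aemeasurable hind.aestronglyMeasurable]
  calc |∫ p, ((τ ⁻¹' B).indicator k p - φ (τ p) * g p) ∂Q|
      ≤ ∫ p, (a * (1 + N p) + M * ‖B.indicator (fun _ => (1 : ℝ)) (τ p) - φ (τ p)‖) ∂Q := by
        rw [← Real.norm_eq_abs]
        refine norm_integral_le_of_norm_le (hdom.add (hindτ.const_mul M))
          (Eventually.of_forall fun p => ?_)
        have h0 : 0 ≤ a * (1 + N p) := (abs_nonneg _).trans (hkg p)
        have hM : ∀ u : ℝ, |u * g p| ≤ M * |u| := fun u => by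
          rw [abs_mul, mul_comm]; exact mul_le_mul_of_nonneg_right (hgM p) (abs_nonneg _)
        by_cases hp : τ p ∈ B
        · have hp' : p ∈ τ ⁻¹' B := hp
          simp only [Set.indicator_of_mem hp, Set.indicator_of_mem hp', Real.norm_eq_abs]
          calc |k p - φ (τ p) * g p| = |(k p - g p) + (1 - φ (τ p)) * g p| := by ring_nf
            _ ≤ |k p - g p| + |(1 - φ (τ p)) * g p| := abs_add_le _ _
            _ ≤ _ := add_le_add (hkg p) (hM _)
        · have hp' : p ∉ τ ⁻¹' B := hp
          simp only [Set.indicator_of_notMem hp, Set.indicator_of_notMem hp', Real.norm_eq_abs]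
          have := hM (0 - φ (τ p))
          rw [sub_mul, zero_mul] at this
          linarith
    _ = a * (1 + ∫ p, N p ∂Q) +
          M * ∫ p, ‖B.indicator (fun _ => (1 : ℝ)) (τ p) - φ (τ p)‖ ∂Q := by
        rw [integral_add hdom (hindτ.const_mul M), integral_const_mul, integral_const_mul,
          integral_add (integrable_const 1) hint]
        simp
    _ ≤ _ := by gcongr

/-- Truncating a function whose square is dominated by `C * (1 + N)` costs a small multiple
of `1 + N`. -/
theorem exists_boundedContinuous_abs_sub_le {h N : X → ℝ} (hh : Continuous h)
    {C : ℝ} (hC : ∀ p, h p ^ 2 ≤ C * (1 + N p)) (hN0 : ∀ p, 0 ≤ N p) {ε : ℝ} (hε : 0 < ε) :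
    ∃ g : BoundedContinuousFunction X ℝ, ∀ p, |h p - g p| ≤ ε * (1 + N p) := by
  obtain ⟨R, hR0, hR⟩ : ∃ R : ℝ, 0 < R ∧ C ≤ 4 * R * ε := by
    refine ⟨(|C| + 1) / ε, by positivity, ?_⟩
    have : 4 * ((|C| + 1) / ε) * ε = 4 * (|C| + 1) := by field_simp
    rw [this]; linarith [le_abs_self C, abs_nonneg C]
  have hb : ∀ p, ‖max (-R) (min R (h p))‖ ≤ R := fun p => by
    rw [Real.norm_eq_abs, abs_le]
    exact ⟨le_max_left _ _, max_le (by linarith) (min_le_left _ _)⟩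
  refine ⟨BoundedContinuousFunction.ofNormedAddCommGroup
    (fun p => max (-R) (min R (h p))) (by fun_prop) R hb, fun p => ?_⟩
  change |h p - max (-R) (min R (h p))| ≤ ε * (1 + N p)
  have hN1 : 0 ≤ 1 + N p := by linarith [hN0 p]
  have key : h p ^ 2 ≤ 4 * R * (ε * (1 + N p)) :=
    (hC p).trans (by nlinarith [mul_le_mul_of_nonneg_right hR hN1])
  rcases le_total R (h p) with h1 | h1
  · rw [min_eq_left h1, max_eq_right (by linarith), abs_of_nonneg (by linarith)]
    have : 4 * R * (h p - R) ≤ 4 * R * (ε * (1 + N p)) := by nlinarith [sq_nonneg (h p - 2 * R)]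
    exact le_of_mul_le_mul_left this (by positivity)
  · rw [min_eq_right h1]
    rcases le_total (-R) (h p) with h2 | h2
    · rw [max_eq_right h2, sub_self, abs_zero]; positivity
    · rw [max_eq_left h2, abs_of_nonpos (by linarith)]
      have : 4 * R * (-(h p - -R)) ≤ 4 * R * (ε * (1 + N p)) := by
        nlinarith [sq_nonneg (h p + 2 * R)]
      exact le_of_mul_le_mul_left this (by positivity)

/-- Convergence of integrals over the (not necessarily open or closed) set `τ ⁻¹' B` for varying
integrands of controlled growth, when all measures share the same image under `τ`. -/
theorem tendsto_setIntegral_of_weakLimit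
    [MeasurableSpace X] [BorelSpace X]
    {S : Type*} [TopologicalSpace S] [MeasurableSpace S] [BorelSpace S] [NormalSpace S]
    {Q : ℕ → Measure X} {P : Measure X}
    [IsProbabilityMeasure P] [∀ n, IsProbabilityMeasure (Q n)]
    (hP : ∀ g : BoundedContinuousFunction X ℝ,
      Tendsto (fun n => ∫ p, g p ∂(Q n)) atTop (nhds (∫ p, g p ∂P)))
    {τ : X → S} (hτ : Continuous τ) {B : Set S} (hB : MeasurableSet B)
    {μ : Measure S} [μ.WeaklyRegular] (hQμ : ∀ n, (Q n).map τ = μ) (hPμ : P.map τ = μ)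
    {N : X → ℝ} (hN0 : ∀ p, 0 ≤ N p) {K : ℝ}
    (hQN : ∀ n, Integrable N (Q n)) (hQK : ∀ n, ∫ p, N p ∂(Q n) ≤ K)
    (hPN : Integrable N P) (hPK : ∫ p, N p ∂P ≤ K)
    {h : X → ℝ} (hh : Continuous h) {C : ℝ} (hC : ∀ p, h p ^ 2 ≤ C * (1 + N p))
    {k : ℕ → X → ℝ} (hk : ∀ n, Continuous (k n))
    (hkh : ∀ ε > 0, ∀ᶠ n in atTop, ∀ p, |k n p - h p| ≤ ε * (1 + N p)) :
    Tendsto (fun n => ∫ p in τ ⁻¹' B, k n p ∂(Q n)) atTop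
      (nhds (∫ p in τ ⁻¹' B, h p ∂P)) := by
  have hK0 : 0 ≤ K := (integral_nonneg hN0).trans hPK
  have hfin : IsFiniteMeasure μ := hPμ ▸ inferInstance
  rw [Metric.tendsto_atTop']
  suffices H : ∀ ε > 0, ∀ᶠ n in atTop,
      |∫ p in τ ⁻¹' B, k n p ∂(Q n) - ∫ p in τ ⁻¹' B, h p ∂P| < ε by
    intro ε hε
    obtain ⟨n₀, hn₀⟩ := eventually_atTop.1 (H ε hε)
    exact ⟨n₀, fun n hn => by rw [Real.dist_eq]; exact hn₀ n hn.le⟩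
  intro ε hε
  set e : ℝ := ε / (8 * (1 + K)) with he
  have he0 : 0 < e := by positivity
  have heK : e * (1 + K) = ε / 8 := by rw [he]; field_simp
  obtain ⟨g, hg⟩ := exists_boundedContinuous_abs_sub_le hh hC hN0 he0
  have hgM : ∀ p, |g p| ≤ ‖g‖ := fun p => g.norm_coe_le_norm p
  obtain ⟨φ, hφ, -⟩ := Integrable.exists_boundedContinuous_integral_sub_le
    (μ := μ) (f := B.indicator fun _ => (1 : ℝ)) ((integrable_const 1).indicator hB)
    (ε := ε / (8 * (‖g‖ + 1))) (by positivity)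
  have hφM : ‖g‖ * ∫ s, ‖B.indicator (fun _ => (1 : ℝ)) s - φ s‖ ∂μ ≤ ε / 8 := by
    calc _ ≤ ‖g‖ * (ε / (8 * (‖g‖ + 1))) := by gcongr
      _ ≤ (‖g‖ + 1) * (ε / (8 * (‖g‖ + 1))) := by gcongr; linarith
      _ = ε / 8 := by field_simp
  have hPe := abs_setIntegral_sub_integral_le hτ hB hPN hPK hh g he0.le hg hgM φ
  have hlim := hP (φ.compContinuous ⟨τ, hτ⟩ * g)
  have hev : ∀ᶠ n in atTop, |∫ p, φ (τ p) * g p ∂(Q n) - ∫ p, φ (τ p) * g p ∂P| < ε / 8 := by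
    have := Metric.tendsto_nhds.1 hlim (ε / 8) (by positivity)
    filter_upwards [this] with n hn
    rw [Real.dist_eq] at hn
    exact hn
  filter_upwards [hkh e he0, hev] with n hn1 hn2
  have hkg : ∀ p, |k n p - g p| ≤ (2 * e) * (1 + N p) := fun p => by
    have := abs_sub_le (k n p) (h p) (g p)
    linarith [hn1 p, hg p]
  have hQe := abs_setIntegral_sub_integral_le hτ hB (hQN n) (hQK n) (hk n) g
    (by positivity) hkg hgM φ
  rw [hQμ] at hQe
  rw [hPμ] at hPe
  rw [abs_le] at hQe hPe
  rw [abs_lt] at hn2 ⊢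
  constructor <;> nlinarith

end WeakLimits

section Torus

theorem isOpenQuotientMap_torusProj (d : ℕ) : IsOpenQuotientMap (torusProj d) :=
  IsOpenQuotientMap.piMap fun _ => QuotientAddGroup.isOpenQuotientMap_mk

theorem exists_int_add_of_torusProj_eq {d : ℕ} {v w : Fin d → ℝ}
    (h : torusProj d v = torusProj d w) : ∃ m : Fin d → ℤ, v = w + fun i => (m i : ℝ) := by
  have H : ∀ i, ∃ m : ℤ, v i = w i + m := fun i => by
    have hi : ((v i - w i : ℝ) : AddCircle (1 : ℝ)) = 0 := by
      rw [AddCircle.coe_sub, sub_eq_zero]; exact congrFun h i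
    obtain ⟨m, hm⟩ := (AddCircle.coe_eq_zero_iff (1 : ℝ)).1 hi
    exact ⟨m, by simp at hm; linarith⟩
  choose m hm using H
  exact ⟨m, funext hm⟩

theorem continuous_of_comp_torusProj {d : ℕ} {A B : Type*} [TopologicalSpace A]
    [TopologicalSpace B] {f : A × Torus d → B}
    (hf : Continuous fun p : A × (Fin d → ℝ) => f (p.1, torusProj d p.2)) : Continuous f :=
  ((IsOpenQuotientMap.id.prodMap (isOpenQuotientMap_torusProj d)).isQuotientMap.continuous_iff).2
    hf

/-- A continuous `ℤ^d`-periodic function descends to the torus. -/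
theorem exists_continuous_torus_descent {d : ℕ} {G : (Fin d → ℝ) → ℝ} (hG : Continuous G)
    (hper : ∀ (w : Fin d → ℝ) (m : Fin d → ℤ), G (w + fun i => (m i : ℝ)) = G w) :
    ∃ H : Torus d → ℝ, Continuous H ∧ ∀ w, H (torusProj d w) = G w := by
  have hq := isOpenQuotientMap_torusProj d
  have hH : ∀ w, G (Function.surjInv hq.surjective (torusProj d w)) = G w := fun w => by
    obtain ⟨m, hm⟩ := exists_int_add_of_torusProj_eq
      (Function.surjInv_eq hq.surjective (torusProj d w))
    rw [hm, hper]
  exact ⟨fun y => G (Function.surjInv hq.surjective y),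
    hq.isQuotientMap.continuous_iff.2 (by simpa [Function.comp_def, hH] using hG), hH⟩

theorem fderiv_apply_periodic {d : ℕ} {F : (Fin d → ℝ) → ℝ}
    (hper : ∀ (w : Fin d → ℝ) (m : Fin d → ℤ), F (w + fun i => (m i : ℝ)) = F w)
    (e w : Fin d → ℝ) (m : Fin d → ℤ) :
    fderiv ℝ F (w + fun i => (m i : ℝ)) e = fderiv ℝ F w e := by
  rw [← fderiv_comp_add_right]
  simp_rw [hper]

end Torus

section Coefficients

variable {d : ℕ}

/-- Bounded continuous functions of `(x, y, z)` that are uniformly Lipschitz in `x`. -/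
structure IsBddLip (k : (Fin d → ℝ) → Torus d → Ctrl d → ℝ) : Prop where
  cont : Continuous fun q : (Fin d → ℝ) × Torus d × Ctrl d => k q.1 q.2.1 q.2.2
  bdd : ∃ C, 0 ≤ C ∧ ∀ x y z, |k x y z| ≤ C
  lip : ∃ C, 0 ≤ C ∧ ∀ x x' y z, |k x y z - k x' y z| ≤ C * ‖x - x'‖

/-- Continuous functions of `(x, y, z)` of at most linear growth in `z`, with a Lipschitz
constant in `x` of at most quadratic growth in `z`. -/
structure HasCtrlGrowth (k : (Fin d → ℝ) → Torus d → Ctrl d → ℝ) : Prop where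
  cont : Continuous fun q : (Fin d → ℝ) × Torus d × Ctrl d => k q.1 q.2.1 q.2.2
  growth : ∃ C, 0 ≤ C ∧ ∀ x y z, k x y z ^ 2 ≤ C * (1 + ∑ i, z i ^ 2)
  lip : ∃ C, 0 ≤ C ∧ ∀ x x' y z, |k x y z - k x' y z| ≤ C * ‖x - x'‖ * (1 + ∑ i, z i ^ 2)

theorem ctrl_sq_sum_nonneg (z : Ctrl d) : 0 ≤ ∑ i, z i ^ 2 :=
  Finset.sum_nonneg fun i _ => sq_nonneg (z i)

namespace IsBddLip

variable {k l : (Fin d → ℝ) → Torus d → Ctrl d → ℝ}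

theorem add (hk : IsBddLip k) (hl : IsBddLip l) :
    IsBddLip fun x y z => k x y z + l x y z := by
  obtain ⟨A, hA, hkA⟩ := hk.bdd
  obtain ⟨B, hB, hlB⟩ := hl.bdd
  obtain ⟨A', hA', hkA'⟩ := hk.lip
  obtain ⟨B', hB', hlB'⟩ := hl.lip
  refine ⟨hk.cont.add hl.cont, ⟨A + B, by positivity, fun x y z => ?_⟩,
    ⟨A' + B', by positivity, fun x x' y z => ?_⟩⟩
  · exact (abs_add_le _ _).trans (add_le_add (hkA x y z) (hlB x y z))
  · rw [add_sub_add_comm, add_mul]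
    exact (abs_add_le _ _).trans (add_le_add (hkA' x x' y z) (hlB' x x' y z))

theorem mul (hk : IsBddLip k) (hl : IsBddLip l) :
    IsBddLip fun x y z => k x y z * l x y z := by
  obtain ⟨A, hA, hkA⟩ := hk.bdd
  obtain ⟨B, hB, hlB⟩ := hl.bdd
  obtain ⟨A', hA', hkA'⟩ := hk.lip
  obtain ⟨B', hB', hlB'⟩ := hl.lip
  refine ⟨hk.cont.mul hl.cont, ⟨A * B, by positivity, fun x y z => ?_⟩,
    ⟨A * B' + A' * B, by positivity, fun x x' y z => ?_⟩⟩
  · rw [abs_mul]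
    exact mul_le_mul (hkA x y z) (hlB x y z) (abs_nonneg _) hA
  · calc |k x y z * l x y z - k x' y z * l x' y z|
        = |k x y z * (l x y z - l x' y z) + (k x y z - k x' y z) * l x' y z| := by ring_nf
      _ ≤ |k x y z| * |l x y z - l x' y z| + |k x y z - k x' y z| * |l x' y z| := by
        rw [← abs_mul, ← abs_mul]; exact abs_add_le _ _
      _ ≤ A * (B' * ‖x - x'‖) + (A' * ‖x - x'‖) * B := by
        gcongr
        exacts [hkA x y z, hlB' x x' y z, hkA' x x' y z, hlB x' y z]
      _ = _ := by ring

theorem of_torus {H : Torus d → ℝ} (hH : Continuous H) : IsBddLip fun _ y _ => H y := by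
  refine ⟨by fun_prop, ?_, ⟨0, le_rfl, fun x x' y z => by simp⟩⟩
  obtain ⟨C, hC⟩ := isCompact_univ.exists_bound_of_continuousOn hH.continuousOn
  exact ⟨C, (norm_nonneg _).trans (hC 0 trivial), fun x y z => hC y trivial⟩

theorem const (a : ℝ) : IsBddLip fun (_ : Fin d → ℝ) (_ : Torus d) (_ : Ctrl d) => a :=
  of_torus (H := fun _ => a) continuous_const

theorem sum {ι : Type*} (s : Finset ι) {f : ι → (Fin d → ℝ) → Torus d → Ctrl d → ℝ}
    (hf : ∀ i, IsBddLip (f i)) : IsBddLip fun x y z => ∑ i ∈ s, f i x y z := by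
  classical
  induction s using Finset.induction_on with
  | empty => simpa using const 0
  | insert i s hi ih => simpa only [Finset.sum_insert hi] using (hf i).add ih

/-- A bounded coefficient with Lipschitz periodic representative. -/
theorem of_lipschitz {a : (Fin d → ℝ) → Torus d → ℝ} {M : ℝ} (hM : ∀ x y, |a x y| ≤ M)
    {L : NNReal}
    (hL : LipschitzWith L fun p : (Fin d → ℝ) × (Fin d → ℝ) => a p.1 (torusProj d p.2)) :
    IsBddLip fun x y _ => a x y := by
  have hc : Continuous fun p : (Fin d → ℝ) × Torus d => a p.1 p.2 :=
    continuous_of_comp_torusProj hL.continuous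
  refine ⟨hc.comp (by fun_prop : Continuous fun q : (Fin d → ℝ) × Torus d × Ctrl d =>
    (q.1, q.2.1)), ⟨M, (abs_nonneg _).trans (hM 0 0), fun x y _ => hM x y⟩,
    ⟨L, L.2, fun x x' y _ => ?_⟩⟩
  obtain ⟨w, rfl⟩ := (isOpenQuotientMap_torusProj d).surjective y
  have := hL.dist_le_mul (x, w) (x', w)
  simpa [Real.dist_eq, Prod.dist_eq, dist_eq_norm] using this

end IsBddLip

namespace HasCtrlGrowth

variable {k l : (Fin d → ℝ) → Torus d → Ctrl d → ℝ}

theorem of_isBddLip (hk : IsBddLip k) : HasCtrlGrowth k := by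
  obtain ⟨A, hA, hkA⟩ := hk.bdd
  obtain ⟨A', hA', hkA'⟩ := hk.lip
  refine ⟨hk.cont, ⟨A ^ 2, by positivity, fun x y z => ?_⟩, ⟨A', hA', fun x x' y z => ?_⟩⟩
  · have h1 : k x y z ^ 2 ≤ A ^ 2 := sq_le_sq' (abs_le.1 (hkA x y z)).1 (abs_le.1 (hkA x y z)).2
    nlinarith [ctrl_sq_sum_nonneg z, mul_nonneg (sq_nonneg A) (ctrl_sq_sum_nonneg z)]
  · refine (hkA' x x' y z).trans (le_mul_of_one_le_right (by positivity) ?_)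
    linarith [ctrl_sq_sum_nonneg z]

theorem add (hk : HasCtrlGrowth k) (hl : HasCtrlGrowth l) :
    HasCtrlGrowth fun x y z => k x y z + l x y z := by
  obtain ⟨A, hA, hkA⟩ := hk.growth
  obtain ⟨B, hB, hlB⟩ := hl.growth
  obtain ⟨A', hA', hkA'⟩ := hk.lip
  obtain ⟨B', hB', hlB'⟩ := hl.lip
  refine ⟨hk.cont.add hl.cont, ⟨2 * (A + B), by positivity, fun x y z => ?_⟩,
    ⟨A' + B', by positivity, fun x x' y z => ?_⟩⟩
  · linarith [add_sq_le (a := k x y z) (b := l x y z), hkA x y z, hlB x y z]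
  · rw [add_sub_add_comm, add_mul, add_mul]
    exact (abs_add_le _ _).trans (add_le_add (hkA' x x' y z) (hlB' x x' y z))

theorem sum {ι : Type*} (s : Finset ι) {f : ι → (Fin d → ℝ) → Torus d → Ctrl d → ℝ}
    (hf : ∀ i, HasCtrlGrowth (f i)) : HasCtrlGrowth fun x y z => ∑ i ∈ s, f i x y z := by
  classical
  induction s using Finset.induction_on with
  | empty => simpa using of_isBddLip (IsBddLip.const 0)
  | insert i s hi ih => simpa only [Finset.sum_insert hi] using (hf i).add ih

theorem bddLip_mul (hk : IsBddLip k) (hl : HasCtrlGrowth l) :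
    HasCtrlGrowth fun x y z => k x y z * l x y z := by
  obtain ⟨A, hA, hkA⟩ := hk.bdd
  obtain ⟨B, hB, hlB⟩ := hl.growth
  obtain ⟨A', hA', hkA'⟩ := hk.lip
  obtain ⟨B', hB', hlB'⟩ := hl.lip
  refine ⟨hk.cont.mul hl.cont, ⟨A ^ 2 * B, by positivity, fun x y z => ?_⟩,
    ⟨A * B' + A' * (1 + B), by positivity, fun x x' y z => ?_⟩⟩
  · have h1 : k x y z ^ 2 ≤ A ^ 2 := sq_le_sq' (abs_le.1 (hkA x y z)).1 (abs_le.1 (hkA x y z)).2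
    rw [mul_pow, mul_assoc]
    exact mul_le_mul h1 (hlB x y z) (sq_nonneg _) (sq_nonneg _)
  · have hl1 : |l x' y z| ≤ (1 + B) * (1 + ∑ i, z i ^ 2) := by
      have h2 : |l x' y z| ≤ 1 + l x' y z ^ 2 := by
        rw [← sq_abs (l x' y z)]; nlinarith [sq_nonneg (|l x' y z| - 1)]
      linarith [hlB x' y z, ctrl_sq_sum_nonneg z]
    calc |k x y z * l x y z - k x' y z * l x' y z|
        = |k x y z * (l x y z - l x' y z) + (k x y z - k x' y z) * l x' y z| := by ring_nf
      _ ≤ |k x y z| * |l x y z - l x' y z| + |k x y z - k x' y z| * |l x' y z| := by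
        rw [← abs_mul, ← abs_mul]; exact abs_add_le _ _
      _ ≤ A * (B' * ‖x - x'‖ * (1 + ∑ i, z i ^ 2)) +
          (A' * ‖x - x'‖) * ((1 + B) * (1 + ∑ i, z i ^ 2)) := by
        gcongr
        exacts [hkA x y z, hlB' x x' y z, hkA' x x' y z]
      _ = _ := by ring

theorem coord (j : Fin d) : HasCtrlGrowth fun (_ : Fin d → ℝ) (_ : Torus d) z => z j := by
  refine ⟨by fun_prop, ⟨1, zero_le_one, fun x y z => ?_⟩, ⟨0, le_rfl, fun x x' y z => by simp⟩⟩
  have := Finset.single_le_sum (f := fun i => z i ^ 2) (fun i _ => sq_nonneg (z i))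
    (Finset.mem_univ j)
  linarith

end HasCtrlGrowth

theorem hasCtrlGrowth_lam2 (γ : ℝ) {b c : (Fin d → ℝ) → Torus d → Fin d → ℝ}
    {σ : (Fin d → ℝ) → Torus d → Matrix (Fin d) (Fin d) ℝ}
    (hb : ∀ i, IsBddLip fun x y _ => b x y i) (hc : ∀ i, IsBddLip fun x y _ => c x y i)
    (hσ : ∀ i j, IsBddLip fun x y _ => σ x y i j) (i : Fin d) :
    HasCtrlGrowth fun x y z => lam2 γ b c σ x y z i :=
  (HasCtrlGrowth.of_isBddLip (((IsBddLip.const γ).mul (hb i)).add (hc i))).add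
    (HasCtrlGrowth.sum Finset.univ fun j =>
      HasCtrlGrowth.bddLip_mul (hσ i j) (HasCtrlGrowth.coord j))

/-- The generator applied to a `C²` function on the torus, as a function on
`ℝ^d × 𝕋^d × ℝ^d`. -/
theorem exists_hasCtrlGrowth_gen2 (γ : ℝ) {b c : (Fin d → ℝ) → Torus d → Fin d → ℝ}
    {σ : (Fin d → ℝ) → Torus d → Matrix (Fin d) (Fin d) ℝ}
    (hb : ∀ i, IsBddLip fun x y _ => b x y i) (hc : ∀ i, IsBddLip fun x y _ => c x y i)
    (hσ : ∀ i j, IsBddLip fun x y _ => σ x y i j)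
    {F : (Fin d → ℝ) → ℝ} (hF : IsC2Periodic F) :
    ∃ k, HasCtrlGrowth k ∧ ∀ x w z, k x (torusProj d w) z = gen2 γ b c σ x z F w := by
  obtain ⟨hF2, hper⟩ := hF
  have hF1 : ∀ e, ContDiff ℝ 1 fun w => fderiv ℝ F w e := fun e =>
    (hF2.fderiv_right (m := 1) (by norm_num)).clm_apply contDiff_const
  have hper1 : ∀ e (w : Fin d → ℝ) (m : Fin d → ℤ),
      (fun v => fderiv ℝ F v e) (w + fun i => (m i : ℝ)) = (fun v => fderiv ℝ F v e) w :=
    fun e w m => fderiv_apply_periodic hper e w m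
  choose D hD hDF using fun i : Fin d =>
    exists_continuous_torus_descent (hF1 (Pi.single i 1)).continuous (hper1 (Pi.single i 1))
  choose E hE hEF using fun i j : Fin d =>
    exists_continuous_torus_descent
      (((hF1 (Pi.single j 1)).continuous_fderiv (by norm_num)).clm_apply
        (continuous_const (y := (Pi.single i 1 : Fin d → ℝ))))
      (fderiv_apply_periodic (hper1 (Pi.single j 1)) (Pi.single i 1))
  refine ⟨fun x y z => (∑ i, D i y * lam2 γ b c σ x y z i) +
    (γ / 2) * ∑ i, ∑ j, (∑ l, σ x y i l * σ x y j l) * E i j y, ?_, fun x w z => ?_⟩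
  · refine (HasCtrlGrowth.sum _ fun i => HasCtrlGrowth.bddLip_mul (IsBddLip.of_torus (hD i))
      (hasCtrlGrowth_lam2 γ hb hc hσ i)).add (HasCtrlGrowth.of_isBddLip ?_)
    exact (IsBddLip.const (γ / 2)).mul (IsBddLip.sum _ fun i => IsBddLip.sum _ fun j =>
      (IsBddLip.sum _ fun l => (hσ i l).mul (hσ j l)).mul (IsBddLip.of_torus (hE i j)))
  · simp only [gen2, hDF, hEF, Matrix.mul_apply, Matrix.transpose_apply]
    exact congrArg (· + _) (Finset.sum_congr rfl fun i _ => mul_comm _ _)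

end Coefficients

open BoundedContinuousFunction in
/-- **The limit of viable pairs is viable** (Lemma on continuity of the viability map,
Regime 2).  If each `(ψⁿ, Pⁿ)` is viable with `∫‖z‖² dPⁿ < K`, `ψⁿ → ψ` uniformly
on `[0,1]`, and `Pⁿ → P` weakly, then `(ψ, P)` is viable. -/
theorem isViablePair_of_limit {d : ℕ} (hd : 1 ≤ d) (γ : ℝ) (hγ : 0 < γ)
    (x₀ : Fin d → ℝ)
    (b c : (Fin d → ℝ) → Torus d → Fin d → ℝ)
    (σ : (Fin d → ℝ) → Torus d → Matrix (Fin d) (Fin d) ℝ)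
    -- boundedness of the coefficients
    (hbB : ∃ M, ∀ x y i, |b x y i| ≤ M) (hcB : ∃ M, ∀ x y i, |c x y i| ≤ M)
    (hσB : ∃ M, ∀ x y i j, |σ x y i j| ≤ M)
    -- Lipschitz continuity of the coefficients (via periodic representatives)
    (hbL : ∃ L : NNReal, ∀ i, LipschitzWith L
      (fun p : (Fin d → ℝ) × (Fin d → ℝ) => b p.1 (torusProj d p.2) i))
    (hcL : ∃ L : NNReal, ∀ i, LipschitzWith L
      (fun p : (Fin d → ℝ) × (Fin d → ℝ) => c p.1 (torusProj d p.2) i))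
    (hσL : ∃ L : NNReal, ∀ i j, LipschitzWith L
      (fun p : (Fin d → ℝ) × (Fin d → ℝ) => σ p.1 (torusProj d p.2) i j))
    -- uniform nondegeneracy of `σσᵀ`
    (hnd : ∃ θ > (0 : ℝ), ∀ x y (ξ : Fin d → ℝ),
      θ * ∑ i, (ξ i) ^ 2 ≤ ξ ⬝ᵥ (σ x y * (σ x y)ᵀ).mulVec ξ)
    (K : ℝ)
    (ψs : ℕ → C(I01, Fin d → ℝ)) (Ps : ℕ → Measure (Spc d))
    (hviable : ∀ n, IsViablePair γ x₀ b c σ (ψs n) (Ps n))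
    (hK : ∀ n, ∫ p, ∑ i, (p.1 i) ^ 2 ∂(Ps n) < K)
    (ψ : C(I01, Fin d → ℝ)) (P : Measure (Spc d)) [IsProbabilityMeasure P]
    -- `ψⁿ → ψ` uniformly on `[0,1]`
    (hψ : TendstoUniformly (fun n => ⇑(ψs n)) (⇑ψ) Filter.atTop)
    -- `Pⁿ → P` weakly
    (hP : ∀ g : Spc d →ᵇ ℝ,
      Filter.Tendsto (fun n => ∫ p, g p ∂(Ps n)) Filter.atTop (nhds (∫ p, g p ∂P))) :
    IsViablePair γ x₀ b c σ ψ P := by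
  have hprob : ∀ n, IsProbabilityMeasure (Ps n) := fun n => (hviable n).1
  obtain ⟨Mb, hMb⟩ := hbB
  obtain ⟨Mc, hMc⟩ := hcB
  obtain ⟨Mσ, hMσ⟩ := hσB
  obtain ⟨Lb, hLb⟩ := hbL
  obtain ⟨Lc, hLc⟩ := hcL
  obtain ⟨Lσ, hLσ⟩ := hσL
  have hb : ∀ i, IsBddLip fun x y (_ : Ctrl d) => b x y i := fun i =>
    IsBddLip.of_lipschitz (fun x y => hMb x y i) (hLb i)
  have hc : ∀ i, IsBddLip fun x y (_ : Ctrl d) => c x y i := fun i =>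
    IsBddLip.of_lipschitz (fun x y => hMc x y i) (hLc i)
  have hσ : ∀ i j, IsBddLip fun x y (_ : Ctrl d) => σ x y i j := fun i j =>
    IsBddLip.of_lipschitz (fun x y => hMσ x y i j) (hLσ i j)
  have hτ : Continuous fun p : Spc d => p.2.2 := by fun_prop
  have hmarg : ∀ n, (Ps n).map (fun p : Spc d => p.2.2) = (Ps 0).map fun p : Spc d => p.2.2 := by
    intro n
    refine Measure.ext_of_Iic _ _ fun t => ?_
    rw [Measure.map_apply hτ.measurable measurableSet_Iic,
      Measure.map_apply hτ.measurable measurableSet_Iic]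
    exact ((hviable n).2.2.2.2 t).trans ((hviable 0).2.2.2.2 t).symm
  have hmargP : P.map (fun p : Spc d => p.2.2) = (Ps 0).map fun p : Spc d => p.2.2 := by
    refine ext_of_forall_integral_eq_of_IsFiniteMeasure fun f => ?_
    have hf : ∀ Q : Measure (Spc d), ∫ s, f s ∂(Q.map fun p : Spc d => p.2.2) =
        ∫ p, (f.compContinuous ⟨_, hτ⟩) p ∂Q := fun Q =>
      integral_map hτ.measurable.aemeasurable f.continuous.aestronglyMeasurable
    have hlim := hP (f.compContinuous ⟨_, hτ⟩)
    simp_rw [← hf, hmarg] at hlim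
    exact tendsto_nhds_unique hlim tendsto_const_nhds
  have hN0 : ∀ p : Spc d, 0 ≤ ∑ i, (p.1 i) ^ 2 := fun p => ctrl_sq_sum_nonneg p.1
  have hQN := fun n => (hviable n).2.1
  obtain ⟨hPN, hPK⟩ := integrable_and_integral_le_of_weakLimit hP
    (by fun_prop : Continuous fun p : Spc d => ∑ i, (p.1 i) ^ 2) hN0 hQN fun n => (hK n).le
  have hconv : ∀ {k : (Fin d → ℝ) → Torus d → Ctrl d → ℝ}, HasCtrlGrowth k → ∀ t : I01,
      Tendsto (fun n => ∫ p in {p : Spc d | (p.2.2 : ℝ) ≤ (t : ℝ)},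
          k (ψs n p.2.2) p.2.1 p.1 ∂(Ps n)) atTop
        (nhds (∫ p in {p : Spc d | (p.2.2 : ℝ) ≤ (t : ℝ)}, k (ψ p.2.2) p.2.1 p.1 ∂P)) := by
    intro k hk t
    have hcont : ∀ χ : C(I01, Fin d → ℝ),
        Continuous fun p : Spc d => k (χ p.2.2) p.2.1 p.1 := fun χ =>
      hk.cont.comp (by fun_prop : Continuous fun p : Spc d => (χ p.2.2, p.2.1, p.1))
    obtain ⟨C, -, hC⟩ := hk.growth
    obtain ⟨L, hL, hkL⟩ := hk.lip
    refine tendsto_setIntegral_of_weakLimit hP hτ (measurableSet_Iic (a := t)) hmarg hmargP hN0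
      hQN (fun n => (hK n).le) hPN hPK (hcont ψ) (fun p => hC _ _ _) (fun n => hcont (ψs n))
      fun ε hε => ?_
    filter_upwards [Metric.tendstoUniformly_iff.1 hψ (ε / (L + 1)) (by positivity)] with n hn p
    refine (hkL _ _ _ _).trans (mul_le_mul_of_nonneg_right ?_ (by linarith [hN0 p]))
    have hnp := (hn p.2.2).le
    rw [dist_comm, dist_eq_norm] at hnp
    calc L * ‖ψs n p.2.2 - ψ p.2.2‖ ≤ (L + 1) * (ε / (L + 1)) := by
          gcongr
          linarith
      _ = ε := by field_simp
  refine ⟨inferInstance, hPN, fun t => ?_, fun F hF g hg t => ?_, fun t => ?_⟩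
  · ext i
    have h1 := (hconv (hasCtrlGrowth_lam2 γ hb hc hσ i) t).const_add (x₀ i)
    have h2 : Tendsto (fun n => ψs n t i) atTop (nhds (ψ t i)) :=
      (tendsto_pi_nhds.1 (hψ.tendsto_at t)) i
    refine tendsto_nhds_unique h2 (h1.congr fun n => ?_)
    exact (congrFun ((hviable n).2.2.1 t) i).symm
  · obtain ⟨k, hk, hkF⟩ := exists_hasCtrlGrowth_gen2 γ hb hc hσ hF
    have hgk : g = fun p => k (ψ p.2.2) p.2.1 p.1 := by
      funext ⟨z, y, s⟩
      obtain ⟨w, rfl⟩ := (isOpenQuotientMap_torusProj d).surjective y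
      rw [hg, hkF]
    rw [hgk]
    refine tendsto_nhds_unique (hconv hk t) (tendsto_const_nhds.congr fun n => ?_)
    exact ((hviable n).2.2.2.1 F hF (fun p => k (ψs n p.2.2) p.2.1 p.1)
      (fun z w s => hkF _ _ _) t).symm
  · have h := congrArg (fun μ => μ (Set.Iic t)) hmargP
    simp only [Measure.map_apply hτ.measurable measurableSet_Iic] at h
    exact h.trans ((hviable 0).2.2.2.2 t)
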